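/- Fix positive integers t ≤ m ≤ n, let X be an m×n matrix of indeterminates over a field 𝔽 of prime characteristic p, R = 𝔽[X] with homogeneous maximal ideal 𝔪, and I_t the ideal of t×t minors of X. Let k be the least integer in [0, t−1] with (m−k)(n−k)/(t−k) ≤ (m−k−1)(n−k−1)/(t−k−1) (division by zero interpreted as infinity). Then there exists a nonnegative integer D such that for every q = p^e, ν_{I_t}(q) ≥ (m−k)(n−k)·l for every positive integer l with l ≤ (q−1−D)/(t−k); consequently fpt(I_t) ≥ (m−k)(n−k)/(t−k) = min{ (m−j)(n−j)/(t−j) : j = 0, 1, …, t−1 }. -/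

import Mathlib

open MvPolynomial

/-- The bracket power `J^{[q]}`: the ideal generated by the `q`-th powers of the
elements of `J`. -/
noncomputable def bracketPow {R : Type*} [CommRing R] (J : Ideal R) (q : ℕ) : Ideal R :=
  Ideal.span ((fun a => a ^ q) '' (J : Set R))

/-- The homogeneous maximal ideal `𝔪` of a polynomial ring, generated by the variables. -/
noncomputable def maxIdl (𝔽 : Type*) [Field 𝔽] (σ : Type*) : Ideal (MvPolynomial σ 𝔽) :=
  Ideal.span (Set.range MvPolynomial.X)

/-- `ν_I(q) = max { r ∈ ℕ | I^r ⊄ 𝔪^{[q]} }`. -/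
noncomputable def nu {𝔽 σ : Type*} [Field 𝔽] (I : Ideal (MvPolynomial σ 𝔽)) (q : ℕ) : ℕ :=
  sSup {r : ℕ | ¬ I ^ r ≤ bracketPow (maxIdl 𝔽 σ) q}

/-- The generic `m × n` matrix `X`, whose entries are the variables `x_{ij}` of the
polynomial ring `𝔽[X]`. -/
noncomputable def genMat (𝔽 : Type*) [Field 𝔽] (m n : ℕ) :
    Matrix (Fin m) (Fin n) (MvPolynomial (Fin m × Fin n) 𝔽) :=
  Matrix.of fun i j => MvPolynomial.X (i, j)

/-- `f` is a size `s` minor of the generic `m × n` matrix: the determinant of the submatrix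
obtained by choosing `s` rows and `s` columns (in increasing order). -/
def IsMinor (𝔽 : Type*) [Field 𝔽] (m n s : ℕ) (f : MvPolynomial (Fin m × Fin n) 𝔽) : Prop :=
  ∃ (row : Fin s → Fin m) (col : Fin s → Fin n), StrictMono row ∧ StrictMono col ∧
    f = ((genMat 𝔽 m n).submatrix row col).det

/-- `I_s ⊆ 𝔽[X]`, the ideal generated by the size `s` minors of the generic matrix. -/
noncomputable def minorsIdeal (𝔽 : Type*) [Field 𝔽] (m n s : ℕ) :
    Ideal (MvPolynomial (Fin m × Fin n) 𝔽) :=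
  Ideal.span {f | IsMinor 𝔽 m n s f}

/-- The condition `(m-k)(n-k)/(t-k) ≤ (m-k-1)(n-k-1)/(t-k-1)`, where a positive integer
divided by zero is interpreted as infinity: for `k = t-1` the right-hand side is infinite
and the condition holds automatically. -/
def minCond (t m n k : ℕ) : Prop :=
  k = t - 1 ∨
    (((m - k) * (n - k) : ℕ) : ℝ) / ((t - k : ℕ) : ℝ) ≤
      (((m - k - 1) * (n - k - 1) : ℕ) : ℝ) / ((t - k - 1 : ℕ) : ℝ)

/-- A form of the valuative criterion for integral dependence on an ideal: if every valuation ring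
of the fraction field `K` that contains `R` has an element of `J` at least as large as `f`, then
some fixed multiple `f ^ d` carries each power of `f` into the same power of `J`. -/
theorem exists_pow_add_mem_pow_of_valuation_le {R : Type*} [CommRing R] [IsDomain R]
    (K : Type*) [Field K] [Algebra R K] [IsFractionRing R K] (J : Ideal R) {f : R} (hf : f ≠ 0)
    (h : ∀ B : ValuationSubring K, (∀ r : R, algebraMap R K r ∈ B) →
      ∃ g ∈ J, B.valuation (algebraMap R K f) ≤ B.valuation (algebraMap R K g)) :
    ∃ d : ℕ, ∀ l : ℕ, f ^ (l + d) ∈ J ^ l := by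
  set L : Ideal R := J ⊔ Ideal.span {f} with hL
  have hfL : f ∈ L := Ideal.mem_sup_right (Ideal.mem_span_singleton_self f)
  have hJL : J ≤ L := le_sup_left
  have hfK : algebraMap R K f ≠ 0 := by
    simpa using (map_ne_zero_iff _ (IsFractionRing.injective R K)).2 hf
  have hfpow (d : ℕ) : f ^ d ∈ L ^ d := Ideal.pow_mem_pow hfL d
  let S : Subring K :=
    { carrier := {x | ∃ d : ℕ, ∃ a ∈ L ^ d, algebraMap R K f ^ d * x = algebraMap R K a}
      mul_mem' := by
        rintro x y ⟨d, a, ha, hx⟩ ⟨e, b, hb, hy⟩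
        refine ⟨d + e, a * b, pow_add L d e ▸ Ideal.mul_mem_mul ha hb, ?_⟩
        rw [map_mul, ← hx, ← hy]; ring
      one_mem' := ⟨0, 1, by simp, by simp⟩
      add_mem' := by
        rintro x y ⟨d, a, ha, hx⟩ ⟨e, b, hb, hy⟩
        refine ⟨d + e, f ^ e * a + f ^ d * b, add_mem ?_ ?_, ?_⟩
        · rw [add_comm d e, pow_add]; exact Ideal.mul_mem_mul (hfpow e) ha
        · rw [pow_add]; exact Ideal.mul_mem_mul (hfpow d) hb
        · simp only [map_add, map_mul, map_pow, ← hx, ← hy]; ring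
      zero_mem' := ⟨0, 0, by simp, by simp⟩
      neg_mem' := by
        rintro x ⟨d, a, ha, hx⟩
        exact ⟨d, -a, neg_mem ha, by rw [map_neg, ← hx]; ring⟩ }
  let P : Ideal S :=
    { carrier := {x | ∃ d : ℕ, ∃ a ∈ J * L ^ d,
        algebraMap R K f ^ (d + 1) * (x : K) = algebraMap R K a}
      add_mem' := by
        rintro x y ⟨d, a, ha, hx⟩ ⟨e, b, hb, hy⟩
        refine ⟨d + e + 1, f ^ (e + 1) * a + f ^ (d + 1) * b, add_mem ?_ ?_, ?_⟩
        · rw [show d + e + 1 = (e + 1) + d by ring, pow_add, mul_left_comm]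
          exact Ideal.mul_mem_mul (hfpow _) ha
        · rw [show d + e + 1 = (d + 1) + e by ring, pow_add, mul_left_comm]
          exact Ideal.mul_mem_mul (hfpow _) hb
        · simp only [map_add, map_mul, map_pow, ← hx, ← hy, Subring.coe_add]; ring
      zero_mem' := ⟨0, 0, by simp, by simp⟩
      smul_mem' := by
        rintro ⟨s, e, b, hb, hs⟩ x ⟨d, a, ha, hx⟩
        refine ⟨e + d, b * a, ?_, ?_⟩
        · rw [pow_add, mul_left_comm]; exact Ideal.mul_mem_mul hb ha
        · simp only [map_mul, ← hx, ← hs, smul_eq_mul, Subring.coe_mul]; ring }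
  by_cases hP : P = ⊤
  · obtain ⟨d, a, ha, h1⟩ : (1 : S) ∈ P := hP ▸ Submodule.mem_top
    have hd : f ^ (d + 1) ∈ J * L ^ d := by
      have : algebraMap R K (f ^ (d + 1)) = algebraMap R K a := by simpa using h1
      rwa [IsFractionRing.injective R K this]
    have hLd : L ^ (d + 1) ≤ J * L ^ d := by
      have key : ∀ e ≤ d + 1, J ^ (d + 1 - e) * Ideal.span {f} ^ e ≤ J * L ^ d := by
        intro e he
        rcases he.lt_or_eq with he | rfl
        · obtain ⟨c, hc⟩ : ∃ c, d + 1 - e = c + 1 := ⟨d - e, by omega⟩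
          have : d = c + e := by omega
          rw [hc, pow_succ', mul_assoc, this, pow_add]
          exact Ideal.mul_mono le_rfl
            (Ideal.mul_mono (Ideal.pow_right_mono hJL c) (Ideal.pow_right_mono le_sup_right e))
        · rw [Nat.sub_self, pow_zero, one_mul, Ideal.span_singleton_pow,
            Ideal.span_singleton_le_iff_mem]
          exact hd
      rw [hL, ← Ideal.add_eq_sup, add_pow, Ideal.sum_eq_sup]
      refine Finset.sup_le fun e he => ?_
      have h1 := key (d + 1 - e) (by omega)
      rw [Nat.sub_sub_self (by simp at he; omega)] at h1
      exact Ideal.mul_le_left.trans h1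
    have hLl (l : ℕ) : L ^ (l + d) ≤ J ^ l * L ^ d := by
      induction l with
      | zero => simp
      | succ l ih =>
        calc L ^ (l + 1 + d) = L * L ^ (l + d) := by ring
          _ ≤ L * (J ^ l * L ^ d) := Ideal.mul_mono le_rfl ih
          _ = J ^ l * L ^ (d + 1) := by ring
          _ ≤ J ^ l * (J * L ^ d) := Ideal.mul_mono le_rfl hLd
          _ = J ^ (l + 1) * L ^ d := by ring
    exact ⟨d, fun l => Ideal.mul_le_left (hLl l (hfpow _))⟩
  · obtain ⟨B, hSB, hPB⟩ := Ideal.image_subset_nonunits_valuationSubring P hP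
    obtain ⟨g, hg, hle⟩ := h B fun r => hSB ⟨0, r, by simp, by simp⟩
    have hdiv : algebraMap R K g / algebraMap R K f ∈ B.nonunits := by
      refine hPB ⟨⟨algebraMap R K g / algebraMap R K f, 1, g, ?_, ?_⟩, ⟨0, g, ?_, ?_⟩, rfl⟩
      · simpa using hJL hg
      · field_simp
      · simpa using hg
      · simp only [zero_add, pow_one]; field_simp
    rw [ValuationSubring.mem_nonunits_iff, map_div₀,
      div_lt_one₀ (zero_lt_iff.2 ((Valuation.ne_zero_iff _).2 hfK))] at hdiv
    exact absurd hle (not_le.2 hdiv)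

/-- The exchange relation between maximal minors. -/
theorem det_mul_det_eq_sum_exchange {R E : Type*} [CommRing R] {m : ℕ}
    (M : Matrix (Fin m) E R) (u w : Fin m → E) (i : Fin m) :
    (M.submatrix id u).det * (M.submatrix id w).det =
      ∑ j, (M.submatrix id (Function.update u i (w j))).det *
        (M.submatrix id (Function.update w j (u i))).det := by
  have hcol (u : Fin m → E) (i : Fin m) (x : E) :
      M.submatrix id (Function.update u i x) = (M.submatrix id u).updateCol i (fun a => M a x) := by
    ext a b
    by_cases hb : b = i
    · subst hb; simp
    · simp [hb]
  have hcr := Matrix.mulVec_cramer (M.submatrix id w) (fun a => M a (u i))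
  have hu : M.submatrix id u = (M.submatrix id u).updateCol i (fun a => M a (u i)) := by
    rw [← hcol, Function.update_eq_self]
  calc (M.submatrix id u).det * (M.submatrix id w).det
      = ((M.submatrix id u).updateCol i
          ((M.submatrix id w).det • fun a => M a (u i))).det := by
        rw [Matrix.det_updateCol_smul, ← hu, mul_comm]
    _ = Matrix.cramer (M.submatrix id u) (∑ j, (Matrix.cramer (M.submatrix id w)
          (fun a => M a (u i)) j) • fun a => M a (w j)) i := by
        rw [← hcr, Matrix.cramer_apply]
        congr 2
        ext a
        simp [Matrix.mulVec, dotProduct, mul_comm]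
    _ = _ := by
        rw [map_sum, Finset.sum_apply]
        refine Finset.sum_congr rfl fun j _ => ?_
        rw [map_smul, Pi.smul_apply, smul_eq_mul, Matrix.cramer_apply, Matrix.cramer_apply, hcol,
          hcol, mul_comm]

theorem sum_update_add {ι E : Type*} [Fintype ι] [DecidableEq ι] (F : E → ℕ) (u : ι → E) (i : ι)
    (x : E) : ∑ k, F (Function.update u i x k) + F (u i) = ∑ k, F (u k) + F x := by
  rw [← Finset.add_sum_erase _ _ (Finset.mem_univ i),
    ← Finset.add_sum_erase _ (fun k => F (u k)) (Finset.mem_univ i),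
    Finset.sum_congr rfl fun k hk => by
      rw [Function.update_of_ne (Finset.ne_of_mem_erase hk)], Function.update_self]
  ring

open Classical in
/-- The number of columns of the selection `u` that belong to `S`. -/
noncomputable def colCount {ι E : Type*} [Fintype ι] (S : Finset E) (u : ι → E) : ℕ :=
  ∑ i, if u i ∈ S then 1 else 0

open Classical in
theorem colCount_eq_card {ι E : Type*} [Fintype ι] (S : Finset E) (u : ι → E) :
    colCount S u = (Finset.univ.filter fun i => u i ∈ S).card :=
  (Finset.card_filter _ _).symm

open Classical in
theorem colCount_update_add {ι E : Type*} [Fintype ι] [DecidableEq ι] (S : Finset E) (u : ι → E)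
    (i : ι) (x : E) : colCount S (Function.update u i x) + (if u i ∈ S then 1 else 0) =
      colCount S u + if x ∈ S then 1 else 0 :=
  sum_update_add (fun x => if x ∈ S then 1 else 0) u i x

/-- The largest value of a valuation `v` on the maximal minors of `M` that use exactly `j` columns
from `S`. -/
noncomputable def maxMinorValue {R Γ₀ E : Type*} [CommRing R]
    [LinearOrderedCommGroupWithZero Γ₀] [Fintype E] {m : ℕ} (v : Valuation R Γ₀)
    (M : Matrix (Fin m) E R) (S : Finset E) (j : ℕ) : Γ₀ :=
  (Finset.univ.filter fun u : Fin m → E => colCount S u = j).sup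
    fun u => v (M.submatrix id u).det

section

variable {R Γ₀ E : Type*} [CommRing R] [LinearOrderedCommGroupWithZero Γ₀] [Fintype E]
  {m : ℕ} (v : Valuation R Γ₀) (M : Matrix (Fin m) E R) (S : Finset E)

theorem le_maxMinorValue {j : ℕ} (u : Fin m → E) (hu : colCount S u = j) :
    v (M.submatrix id u).det ≤ maxMinorValue v M S j :=
  Finset.le_sup (f := fun u => v (M.submatrix id u).det) (by simpa using hu)

theorem exists_eq_maxMinorValue {j : ℕ} (h : maxMinorValue v M S j ≠ 0) (W : (Fin m → E) → ℕ) :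
    ∃ u : Fin m → E, colCount S u = j ∧
      v (M.submatrix id u).det = maxMinorValue v M S j ∧
      ∀ u' : Fin m → E, colCount S u' = j →
        v (M.submatrix id u').det = maxMinorValue v M S j → W u ≤ W u' := by
  have hne : (Finset.univ.filter fun u : Fin m → E =>
      colCount S u = j).Nonempty := by
    rw [Finset.nonempty_iff_ne_empty]
    intro h0
    apply h
    rw [maxMinorValue, h0, Finset.sup_empty, bot_eq_zero]
  obtain ⟨u₀, hu₀, hv₀⟩ := Finset.exists_mem_eq_sup _ hne fun u => v (M.submatrix id u).det
  obtain ⟨u, hu, hmin⟩ := Finset.exists_min_image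
    (Finset.univ.filter fun u : Fin m → E => colCount S u = j ∧
      v (M.submatrix id u).det = maxMinorValue v M S j) W
    ⟨u₀, by simpa using ⟨by simpa using hu₀, hv₀.symm⟩⟩
  simp only [Finset.mem_filter, Finset.mem_univ, true_and] at hu hmin
  exact ⟨u, hu.1, hu.2, fun u' h1 h2 => hmin u' ⟨h1, h2⟩⟩

omit [Fintype E] in
theorem injective_of_det_submatrix_ne_zero {u : Fin m → E} (h : (M.submatrix id u).det ≠ 0) :
    Function.Injective u := by
  intro i j hij
  by_contra hne
  exact h (Matrix.det_zero_of_column_eq hne fun k => by simp [hij])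

open Classical in
/-- The maximal values on minors with a prescribed number of columns from `S` are log-concave. -/
theorem maxMinorValue_mul_le (j : ℕ) :
    maxMinorValue v M S (j + 2) * maxMinorValue v M S j ≤ maxMinorValue v M S (j + 1) ^ 2 := by
  by_cases h2 : maxMinorValue v M S (j + 2) = 0
  · simp [h2]
  by_cases h0 : maxMinorValue v M S j = 0
  · simp [h0]
  obtain ⟨φ, hφ⟩ : ∃ φ : E → ℕ, Function.Injective φ :=
    ⟨fun x => Fintype.equivFin E x, fun x y h => (Fintype.equivFin E).injective (Fin.ext h)⟩
  obtain ⟨u, hu, hvu, hWu⟩ := exists_eq_maxMinorValue v M S h2 fun u => ∑ i, φ (u i)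
  obtain ⟨w, hw, hvw, hWw⟩ := exists_eq_maxMinorValue v M S h0 fun u => ∑ i, φ (u i)
  have hinj : Function.Injective u := by
    refine injective_of_det_submatrix_ne_zero M fun h => h2 ?_
    rw [← hvu, h, map_zero]
  obtain ⟨x, hx, hxw⟩ := Finset.exists_mem_notMem_of_card_lt_card
    (s := (Finset.univ.filter fun i => w i ∈ S).image w)
    (t := (Finset.univ.filter fun i => u i ∈ S).image u) (by
      rw [Finset.card_image_of_injective _ hinj]
      refine Finset.card_image_le.trans_lt ?_
      rw [← colCount_eq_card, ← colCount_eq_card, hu, hw]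
      omega)
  obtain ⟨i, hi, rfl⟩ := Finset.mem_image.1 hx
  replace hi : u i ∈ S := by simpa using hi
  have hiw (k : Fin m) : w k ≠ u i := fun h =>
    hxw (Finset.mem_image.2 ⟨k, by simp [h, hi], h⟩)
  have hpos : maxMinorValue v M S (j + 2) * maxMinorValue v M S j ≠ 0 := mul_ne_zero h2 h0
  obtain ⟨k, hk⟩ : ∃ k, maxMinorValue v M S (j + 2) * maxMinorValue v M S j ≤
      v (M.submatrix id (Function.update u i (w k))).det *
        v (M.submatrix id (Function.update w k (u i))).det := by
    by_contra! hlt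
    refine (v.map_sum_lt (s := Finset.univ) (f := fun k =>
      (M.submatrix id (Function.update u i (w k))).det *
        (M.submatrix id (Function.update w k (u i))).det) hpos
      fun k _ => by rw [map_mul]; exact hlt k).ne ?_
    rw [← det_mul_det_eq_sum_exchange, map_mul, hvu, hvw]
  have hcu := colCount_update_add S u i (w k)
  have hcw := colCount_update_add S w k (u i)
  simp only [hi, if_true, hu, hw] at hcu hcw
  by_cases hwk : w k ∈ S
  · simp only [hwk, if_true, add_left_inj] at hcu hcw
    have h1 := le_maxMinorValue v M S _ hcu
    have h3 := le_maxMinorValue v M S _ hcw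
    have e1 : v (M.submatrix id (Function.update u i (w k))).det = maxMinorValue v M S (j + 2) := by
      by_contra hne
      exact hk.not_gt (mul_lt_mul_of_lt_of_le_of_nonneg_of_pos (lt_of_le_of_ne h1 hne)
        h3 zero_le (zero_lt_iff.2 h0))
    have e2 : v (M.submatrix id (Function.update w k (u i))).det = maxMinorValue v M S j := by
      by_contra hne
      exact hk.not_gt (mul_lt_mul_of_le_of_lt_of_nonneg_of_pos h1
        (lt_of_le_of_ne h3 hne) zero_le (zero_lt_iff.2 h2))
    have a1 := hWu _ hcu e1
    have a2 := hWw _ hcw e2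
    have b1 := sum_update_add φ u i (w k)
    have b2 := sum_update_add φ w k (u i)
    exact absurd (hφ (by omega : φ (w k) = φ (u i))) (hiw k)
  · simp only [hwk, if_false, add_zero] at hcu hcw
    rw [sq]
    exact hk.trans (mul_le_mul' (le_maxMinorValue v M S _ (by omega))
      (le_maxMinorValue v M S _ hcw))

end

/-- A product of terms of a log-concave sequence `a` with `a 0 = 1` and `a 1 ≤ 1` is bounded by a
power of `a t` as soon as this holds for the sequences `c ^ (j - i)` with `i < t` and `c ≤ 1`. -/
theorem prod_pow_le_pow_of_logConcave {Γ₀ ι : Type*} [LinearOrderedCommGroupWithZero Γ₀] [Fintype ι]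
    {a : ℕ → Γ₀} {M : ℕ} (h0 : a 0 = 1) (h1 : a 1 ≤ 1) (hne : ∀ j ≤ M, a j ≠ 0)
    (hc : ∀ j, a (j + 2) * a j ≤ a (j + 1) ^ 2) {ℓ : ι → ℕ} (hℓ : ∀ d, ℓ d ≤ M) {t r N : ℕ}
    (ht : t ≤ M) (hN : ∀ i < t, N * (t - i) ≤ r * ∑ d, (ℓ d - i)) :
    ∏ d, a (ℓ d) ^ r ≤ a t ^ N := by
  let e : ℕ → Γ₀ := fun i => Nat.casesOn i (a 1) fun i => a (i + 2) * a i / a (i + 1) ^ 2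
  have he (i : ℕ) : e i ≤ 1 := by
    cases i with
    | zero => exact h1
    | succ i => exact div_le_one_of_le₀ (hc i) zero_le
  have hstep (j : ℕ) (hj : j + 1 ≤ M) : a (j + 1) = a j * ∏ i ∈ Finset.range (j + 1), e i := by
    induction j with
    | zero => simp [h0, e]
    | succ j ih =>
      have hj0 := hne j (by omega)
      have hj1 := hne (j + 1) (by omega)
      have hP : ∏ i ∈ Finset.range (j + 1), e i = a (j + 1) / a j := by
        rw [eq_div_iff hj0, mul_comm, ← ih (by omega)]
      rw [Finset.prod_range_succ, hP]
      change _ = a (j + 1) * (a (j + 1) / a j * (a (j + 2) * a j / a (j + 1) ^ 2))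
      field_simp
  have ha (j : ℕ) (hj : j ≤ M) : a j = ∏ i ∈ Finset.range M, e i ^ (j - i) := by
    induction j with
    | zero => simp [h0]
    | succ j ih =>
      rw [hstep j hj, ih (by omega), ← Finset.prod_subset (Finset.range_subset_range.2 hj)
        (f := fun i => e i ^ (j + 1 - i)) fun i _ hi => by
          rw [Nat.sub_eq_zero_of_le (by simpa using hi), pow_zero],
        ← Finset.prod_subset (Finset.range_subset_range.2 hj)
        (f := fun i => e i ^ (j - i)) fun i _ hi => by
          rw [Nat.sub_eq_zero_of_le (by simp at hi; omega), pow_zero], ← Finset.prod_mul_distrib]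
      refine Finset.prod_congr rfl fun i hi => ?_
      rw [← pow_succ, Nat.sub_add_comm (by simp at hi; omega)]
  calc ∏ d, a (ℓ d) ^ r = ∏ i ∈ Finset.range M, e i ^ (r * ∑ d, (ℓ d - i)) := by
        rw [Finset.prod_congr rfl fun d _ => by rw [ha _ (hℓ d)], Finset.prod_pow,
          Finset.prod_comm, ← Finset.prod_pow]
        refine Finset.prod_congr rfl fun i _ => ?_
        rw [Finset.prod_pow_eq_pow_sum, ← pow_mul, mul_comm]
    _ ≤ ∏ i ∈ Finset.range M, e i ^ (N * (t - i)) := by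
        refine Finset.prod_le_prod' fun i _ => pow_le_pow_right_of_le_one' (he i) ?_
        rcases lt_or_ge i t with hi | hi
        · exact hN i hi
        · simp [Nat.sub_eq_zero_of_le hi]
    _ = a t ^ N := by
        rw [ha t ht, ← Finset.prod_pow]
        refine Finset.prod_congr rfl fun i _ => ?_
        rw [← pow_mul, mul_comm]

theorem det_submatrix_mem_minorsIdeal (𝔽 : Type*) [Field 𝔽] {m n s : ℕ} (r : Fin s → Fin m)
    (c : Fin s → Fin n) : ((genMat 𝔽 m n).submatrix r c).det ∈ minorsIdeal 𝔽 m n s := by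
  by_cases hr : Function.Injective r
  · by_cases hc : Function.Injective c
    · have h : (genMat 𝔽 m n).submatrix r c = (((genMat 𝔽 m n).submatrix (r ∘ Tuple.sort r)
          (c ∘ Tuple.sort c)).submatrix (Tuple.sort r).symm id).submatrix id
          (Tuple.sort c).symm := by
        ext i j
        simp
      rw [h, Matrix.det_permute', Matrix.det_permute]
      exact Ideal.mul_mem_left _ _ (Ideal.mul_mem_left _ _ (Ideal.subset_span
        ⟨_, _, (Tuple.monotone_sort r).strictMono_of_injective (hr.comp (Equiv.injective _)),
          (Tuple.monotone_sort c).strictMono_of_injective (hc.comp (Equiv.injective _)), rfl⟩))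
    · obtain ⟨i, j, hij, hne⟩ := Function.not_injective_iff.1 hc
      rw [Matrix.det_zero_of_column_eq hne fun k => by simp [hij]]
      exact zero_mem _
  · obtain ⟨i, j, hij, hne⟩ := Function.not_injective_iff.1 hr
    rw [Matrix.det_zero_of_row_eq hne (by ext k; simp [hij])]
    exact zero_mem _

/-- The determinant of a square matrix that has `#T` columns taken from the generic matrix lies in
`I_{#T}`. -/
theorem det_mem_minorsIdeal_card (𝔽 : Type*) [Field 𝔽] {m n N : ℕ} (r : Fin N → Fin m)
    (A : Matrix (Fin N) (Fin N) (MvPolynomial (Fin m × Fin n) 𝔽)) (T : Finset (Fin N))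
    (c : Fin N → Fin n) (hA : ∀ k ∈ T, ∀ i, A i k = genMat 𝔽 m n (r i) (c k)) :
    A.det ∈ minorsIdeal 𝔽 m n T.card := by
  induction N with
  | zero =>
    obtain rfl : T = Finset.univ := Subsingleton.elim _ _
    rw [show A = (genMat 𝔽 m n).submatrix r c from Subsingleton.elim _ _]
    exact det_submatrix_mem_minorsIdeal 𝔽 r c
  | succ N ih =>
    by_cases hT : T = Finset.univ
    · obtain rfl : A = (genMat 𝔽 m n).submatrix r c := by
        ext1 i k
        exact hA k (hT ▸ Finset.mem_univ k) i
      rw [hT, Finset.card_univ, Fintype.card_fin]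
      exact det_submatrix_mem_minorsIdeal 𝔽 r c
    · obtain ⟨k, hk⟩ : ∃ k, k ∉ T := by
        by_contra! h
        exact hT (Finset.eq_univ_iff_forall.2 h)
      have hcard : (T.preimage k.succAbove Fin.succAbove_right_injective.injOn).card = T.card := by
        rw [Finset.card_preimage, Finset.filter_true_of_mem]
        intro x hx
        rw [Fin.range_succAbove]
        rintro rfl
        exact hk hx
      rw [Matrix.det_succ_column A k]
      refine sum_mem fun i _ => Ideal.mul_mem_left _ _ ?_
      rw [← hcard]
      exact ih (r ∘ i.succAbove) _ _ (c ∘ k.succAbove) fun l hl j => by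
        simpa using hA _ (Finset.mem_preimage.1 hl) (i.succAbove j)

/-- The matrix `[1 | X]`, whose maximal minors are up to sign the minors of `X` of all sizes. -/
noncomputable def extMat (𝔽 : Type*) [Field 𝔽] (m n : ℕ) :
    Matrix (Fin m) (Fin m ⊕ Fin n) (MvPolynomial (Fin m × Fin n) 𝔽) :=
  Matrix.fromCols 1 (genMat 𝔽 m n)

/-- The positions of the columns of `X` in `[1 | X]`. -/
def genCols (m n : ℕ) : Finset (Fin m ⊕ Fin n) :=
  Finset.univ.filter fun x => x.isRight

theorem det_extMat_mem_minorsIdeal (𝔽 : Type*) [Field 𝔽] {m n : ℕ} (u : Fin m → Fin m ⊕ Fin n) :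
    ((extMat 𝔽 m n).submatrix id u).det ∈
      minorsIdeal 𝔽 m n (colCount (genCols m n) u) := by
  by_cases hn : Nonempty (Fin n)
  · rw [colCount_eq_card]
    refine det_mem_minorsIdeal_card 𝔽 id _ _ (fun k => (u k).elim (fun _ => hn.some) id)
      fun k hk i => ?_
    obtain ⟨y, hy⟩ : ∃ y, u k = Sum.inr y := by
      simpa [genCols, Sum.isRight_iff] using hk
    simp [extMat, hy]
  · have h (x : Fin m ⊕ Fin n) : x ∉ genCols m n := by
      rcases x with x | x
      · simp [genCols]
      · exact absurd ⟨x⟩ hn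
    have : minorsIdeal 𝔽 m n 0 = ⊤ := by
      rw [Ideal.eq_top_iff_one]
      exact Ideal.subset_span ⟨Fin.elim0, Fin.elim0, fun i => i.elim0, fun i => i.elim0, by simp⟩
    simp [colCount, h, this]

theorem exists_det_extMat_eq_minor (𝔽 : Type*) [Field 𝔽] {m n s : ℕ} {row : Fin s → Fin m}
    (hrow : Function.Injective row) (col : Fin s → Fin n) :
    ∃ u : Fin m → Fin m ⊕ Fin n, colCount (genCols m n) u = s ∧
      ((extMat 𝔽 m n).submatrix id u).det = ((genMat 𝔽 m n).submatrix row col).det := by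
  set u : Fin m → Fin m ⊕ Fin n := Function.extend row (Sum.inr ∘ col) Sum.inl with hu
  have hu1 (i : Fin s) : u (row i) = Sum.inr (col i) := hrow.extend_apply _ _ i
  have hu2 (i : Fin m) (hi : i ∉ Set.range row) : u i = Sum.inl i :=
    Function.extend_apply' _ _ _ hi
  refine ⟨u, ?_, ?_⟩
  · rw [colCount_eq_card]
    refine (congrArg Finset.card (?_ : _ = Finset.univ.image row)).trans
      (by rw [Finset.card_image_of_injective _ hrow, Finset.card_univ, Fintype.card_fin])
    ext i
    by_cases hi : i ∈ Set.range row
    · obtain ⟨k, rfl⟩ := hi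
      simp [hu1, genCols]
    · simpa [hu2 i hi, genCols] using hi
  · rw [Matrix.twoBlockTriangular_det _ (fun i => i ∉ Set.range row)]
    · have h1 : Matrix.toSquareBlockProp ((extMat 𝔽 m n).submatrix id u)
          (fun i => i ∉ Set.range row) = 1 := by
        ext1 i j
        simp [Matrix.toSquareBlockProp, extMat, hu2 j j.2, Matrix.one_apply, Subtype.ext_iff]
      rw [h1, Matrix.det_one, one_mul]
      let e : Fin s ≃ {i // ¬ i ∉ Set.range row} :=
        (Equiv.ofInjective row hrow).trans (Equiv.subtypeEquivRight fun i => by simp)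
      rw [← Matrix.det_submatrix_equiv_self e]
      congr 1
      ext1 i j
      simp [Matrix.toSquareBlockProp, extMat, e, hu1]
    · rintro i hi j hj
      have : i ≠ j := by rintro rfl; exact hi hj
      simp [extMat, hu2 j hj, this]

theorem bracketPow_maxIdl_eq_span {𝔽 σ : Type*} [Field 𝔽] {p : ℕ} (hp : p.Prime) [CharP 𝔽 p]
    (e : ℕ) : bracketPow (maxIdl 𝔽 σ) (p ^ e) =
      Ideal.span (Set.range fun i => (X i : MvPolynomial σ 𝔽) ^ p ^ e) := by
  have : Fact p.Prime := ⟨hp⟩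
  change Ideal.map (iterateFrobenius (MvPolynomial σ 𝔽) p e) (maxIdl 𝔽 σ) = _
  rw [maxIdl, Ideal.map_span, ← Set.range_comp]
  rfl

theorem mem_bracketPow_maxIdl {𝔽 σ : Type*} [Field 𝔽] {p : ℕ} (hp : p.Prime) [CharP 𝔽 p] (e : ℕ)
    (f : MvPolynomial σ 𝔽) :
    f ∈ bracketPow (maxIdl 𝔽 σ) (p ^ e) ↔ ∀ s ∈ f.support, ∃ i, p ^ e ≤ s i := by
  have h : bracketPow (maxIdl 𝔽 σ) (p ^ e) = Ideal.span
      ((fun s => monomial s (1 : 𝔽)) '' Set.range fun i : σ => Finsupp.single i (p ^ e)) := by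
    rw [bracketPow_maxIdl_eq_span hp, ← Set.range_comp]
    congr 2
    ext1 i
    simp [X_pow_eq_monomial]
  rw [h, mem_ideal_span_monomial_image]
  simp

theorem pow_notMem_bracketPow {𝔽 σ : Type*} [Field 𝔽] {p : ℕ} (hp : p.Prime) [CharP 𝔽 p] {e : ℕ}
    {f : MvPolynomial σ 𝔽} (hf : f ∉ bracketPow (maxIdl 𝔽 σ) (p ^ e)) :
    f ^ p ∉ bracketPow (maxIdl 𝔽 σ) (p ^ (e + 1)) := by
  have : Fact p.Prime := ⟨hp⟩
  rw [mem_bracketPow_maxIdl hp] at hf ⊢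
  push Not at hf ⊢
  obtain ⟨s, hs, hlt⟩ := hf
  refine ⟨p • s, ?_, fun i => ?_⟩
  · rw [mem_support_iff, ← map_frobenius_expand p, coeff_map, coeff_expand_smul p hp.ne_zero]
    simpa using hs
  · rw [pow_succ', Finsupp.smul_apply, smul_eq_mul]
    exact Nat.mul_lt_mul_of_pos_left (hlt i) hp.pos

theorem pow_le_bracketPow {𝔽 σ : Type*} [Field 𝔽] [Fintype σ] {p : ℕ} (hp : p.Prime) [CharP 𝔽 p]
    (e : ℕ) {r : ℕ} (hr : Fintype.card σ * p ^ e ≤ r) (hr0 : 0 < r) :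
    maxIdl 𝔽 σ ^ r ≤ bracketPow (maxIdl 𝔽 σ) (p ^ e) := by
  intro f hf
  rw [mem_bracketPow_maxIdl hp]
  intro s hs
  by_contra! hlt
  have hdeg : r ≤ s.degree := (mem_pow_idealOfVars_iff r f).1 hf s hs
  rw [Finsupp.degree_eq_sum] at hdeg
  cases isEmpty_or_nonempty σ
  · simp at hdeg; omega
  · have : ∑ i, s i < ∑ _i : σ, p ^ e :=
      Finset.sum_lt_sum_of_nonempty Finset.univ_nonempty fun i _ => hlt i
    rw [Finset.sum_const, Finset.card_univ, smul_eq_mul] at this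
    omega

section

variable {𝔽 σ : Type*} [Field 𝔽] [Fintype σ] {p : ℕ} (hp : p.Prime) [CharP 𝔽 p]
  {I : Ideal (MvPolynomial σ 𝔽)} (hI : I ≤ maxIdl 𝔽 σ)

include hp hI in
theorem le_of_not_pow_le (e : ℕ) {r : ℕ}
    (hr : ¬ I ^ r ≤ bracketPow (maxIdl 𝔽 σ) (p ^ e)) : r ≤ Fintype.card σ * p ^ e := by
  by_contra! h
  exact hr ((Ideal.pow_right_mono hI r).trans (pow_le_bracketPow hp e h.le (by omega)))

include hp hI in
theorem le_nu (e : ℕ) {r : ℕ} (hr : ¬ I ^ r ≤ bracketPow (maxIdl 𝔽 σ) (p ^ e)) :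
    r ≤ nu I (p ^ e) :=
  le_csSup ⟨_, fun _ h => le_of_not_pow_le hp hI e h⟩ hr

include hp hI in
theorem not_pow_nu_le (e : ℕ) : ¬ I ^ nu I (p ^ e) ≤ bracketPow (maxIdl 𝔽 σ) (p ^ e) := by
  refine Nat.sSup_mem (s := {r : ℕ | ¬ I ^ r ≤ bracketPow (maxIdl 𝔽 σ) (p ^ e)}) ⟨0, ?_⟩
    ⟨_, fun _ h => le_of_not_pow_le hp hI e h⟩
  rw [Set.mem_ofPred_eq, pow_zero, Ideal.one_eq_top]
  intro h
  obtain ⟨i, hi⟩ := (mem_bracketPow_maxIdl hp e 1).1 (h (Submodule.mem_top (x := 1))) 0 (by simp)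
  simp [hp.ne_zero] at hi

include hp hI in
theorem mul_nu_le (e : ℕ) : p * nu I (p ^ e) ≤ nu I (p ^ (e + 1)) := by
  obtain ⟨f, hf, hfq⟩ := SetLike.not_le_iff_exists.1 (not_pow_nu_le hp hI e)
  refine le_nu hp hI (e + 1) (SetLike.not_le_iff_exists.2 ⟨f ^ p, ?_, pow_notMem_bracketPow hp hfq⟩)
  rw [mul_comm, pow_mul]
  exact Ideal.pow_mem_pow hf p

include hp hI in
theorem exists_tendsto_nu_div : ∃ c : ℝ, Filter.Tendsto
    (fun e : ℕ => (nu I (p ^ e) : ℝ) / (p ^ e : ℕ)) Filter.atTop (nhds c) := by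
  have hp0 : (0 : ℝ) < p := by exact_mod_cast hp.pos
  refine ⟨_, tendsto_atTop_ciSup (monotone_nat_of_le_succ fun e => ?_)
    ⟨Fintype.card σ, ?_⟩⟩
  · have h : (p : ℝ) * nu I (p ^ e) ≤ nu I (p ^ (e + 1)) := by exact_mod_cast mul_nu_le hp hI e
    push_cast
    rw [div_le_div_iff₀ (by positivity) (by positivity), pow_succ]
    calc (nu I (p ^ e) : ℝ) * (p ^ e * p) = (p * nu I (p ^ e)) * p ^ e := by ring
      _ ≤ _ := by gcongr
  · rintro _ ⟨e, rfl⟩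
    have h := le_of_not_pow_le hp hI e (not_pow_nu_le hp hI e)
    push_cast
    rw [div_le_iff₀ (by positivity)]
    exact_mod_cast h

end

/-- The weighting of the variables for which the leading term of each minor is the product of its
diagonal entries. -/
noncomputable def diagWeight (𝔽 : Type*) [Field 𝔽] (m n : ℕ) :
    MvPolynomial (Fin m × Fin n) 𝔽 →ₐ[𝔽] Polynomial (MvPolynomial (Fin m × Fin n) 𝔽) :=
  aeval fun c => Polynomial.C (X c) * Polynomial.X ^ ((c.1 : ℕ) * (c.2 : ℕ))

theorem leadingCoeff_diagWeight_mem {𝔽 : Type*} [Field 𝔽] {m n : ℕ} {p : ℕ} (hp : p.Prime)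
    [CharP 𝔽 p] (e : ℕ) {f : MvPolynomial (Fin m × Fin n) 𝔽}
    (hf : f ∈ bracketPow (maxIdl 𝔽 (Fin m × Fin n)) (p ^ e)) :
    (diagWeight 𝔽 m n f).leadingCoeff ∈ bracketPow (maxIdl 𝔽 (Fin m × Fin n)) (p ^ e) := by
  have hmap : (bracketPow (maxIdl 𝔽 (Fin m × Fin n)) (p ^ e)).map (diagWeight 𝔽 m n) ≤
      (bracketPow (maxIdl 𝔽 (Fin m × Fin n)) (p ^ e)).map Polynomial.C := by
    rw [bracketPow_maxIdl_eq_span hp, Ideal.map_span, Ideal.span_le]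
    rintro _ ⟨_, ⟨c, rfl⟩, rfl⟩
    rw [SetLike.mem_coe, map_pow, diagWeight, aeval_X, mul_pow, ← Polynomial.C_pow]
    exact Ideal.mul_mem_right _ _ (Ideal.mem_map_of_mem _ (Ideal.subset_span ⟨c, rfl⟩))
  exact Ideal.mem_map_C_iff.1 (hmap (Ideal.mem_map_of_mem _ hf)) _

theorem sum_comp_perm_mul_lt {s m n : ℕ} {row : Fin s → Fin m} {col : Fin s → Fin n}
    (hrow : StrictMono row) (hcol : StrictMono col) {σ : Equiv.Perm (Fin s)} (hσ : σ ≠ 1) :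
    ∑ i, (row (σ i) : ℕ) * (col i : ℕ) < ∑ i, (row i : ℕ) * (col i : ℕ) := by
  have hmono : Monovary (fun i => (row i : ℕ)) (fun i => (col i : ℕ)) := fun i j hij =>
    hrow.monotone (hcol.lt_iff_lt.1 hij).le
  refine (hmono.sum_comp_perm_mul_lt_sum_mul_iff (σ := σ)).2 fun h => hσ ?_
  have hσm : StrictMono σ := fun i j hij =>
    lt_of_le_of_ne (hrow.le_iff_le.1 (h (hcol hij))) (σ.injective.ne hij.ne)
  ext1 i
  exact congrFun ((hσm.range_inj strictMono_id).1 (by simp [σ.surjective.range_eq])) i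

theorem leadingCoeff_diagWeight_minor (𝔽 : Type*) [Field 𝔽] {m n s : ℕ} {row : Fin s → Fin m}
    {col : Fin s → Fin n} (hrow : StrictMono row) (hcol : StrictMono col) :
    (diagWeight 𝔽 m n ((genMat 𝔽 m n).submatrix row col).det).leadingCoeff =
      ∏ i, X (row i, col i) := by
  set N := ∑ i, (row i : ℕ) * (col i : ℕ) with hN
  have hterm (σ : Equiv.Perm (Fin s)) :
      diagWeight 𝔽 m n (∏ i, (genMat 𝔽 m n).submatrix row col (σ i) i) =
        Polynomial.C (∏ i, X (row (σ i), col i)) *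
          Polynomial.X ^ ∑ i, (row (σ i) : ℕ) * (col i : ℕ) := by
    rw [map_prod, map_prod, ← Finset.prod_pow_eq_pow_sum, ← Finset.prod_mul_distrib]
    exact Finset.prod_congr rfl fun i _ => by simp [genMat, diagWeight]
  have hlead : ((Polynomial.C (∏ i, X (row i, col i)) * Polynomial.X ^ N :
      Polynomial (MvPolynomial (Fin m × Fin n) 𝔽))).degree = N :=
    Polynomial.degree_C_mul_X_pow _ (Finset.prod_ne_zero_iff.2 fun i _ => X_ne_zero _)
  rw [Matrix.det_apply', ← Finset.add_sum_erase _ _ (Finset.mem_univ 1), map_add, map_mul, hterm,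
    map_sum]
  simp only [Units.val_one, Int.cast_one, map_one, one_mul,
    Equiv.Perm.one_apply, ← hN]
  rw [Polynomial.leadingCoeff_add_of_degree_lt', Polynomial.leadingCoeff_C_mul_X_pow]
  rw [hlead, ← Polynomial.mem_degreeLT]
  refine sum_mem fun σ hσ => ?_
  rw [map_mul, map_intCast, ← zsmul_eq_mul]
  refine zsmul_mem ?_ _
  rw [hterm, Polynomial.mem_degreeLT]
  refine (Polynomial.degree_C_mul_X_pow_le _ _).trans_lt ?_
  exact_mod_cast sum_comp_perm_mul_lt hrow hcol (Finset.ne_of_mem_erase hσ)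

/-- The first cells of the diagonals of an `m × n` array. -/
def diagStart (m n : ℕ) : Fin n ⊕ Fin (m - 1) → ℕ × ℕ :=
  Sum.elim (fun b => (0, b)) (fun a => (a + 1, 0))

/-- The lengths of the diagonals of an `m × n` array. -/
def diagLen (m n : ℕ) (d : Fin n ⊕ Fin (m - 1)) : ℕ :=
  min (m - (diagStart m n d).1) (n - (diagStart m n d).2)

/-- The rows met by a diagonal. -/
def diagRow (m n : ℕ) (d : Fin n ⊕ Fin (m - 1)) (s : Fin (diagLen m n d)) : Fin m :=
  ⟨(diagStart m n d).1 + s, by have := s.2; simp only [diagLen] at this; omega⟩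

/-- The columns met by a diagonal. -/
def diagCol (m n : ℕ) (d : Fin n ⊕ Fin (m - 1)) (s : Fin (diagLen m n d)) : Fin n :=
  ⟨(diagStart m n d).2 + s, by have := s.2; simp only [diagLen] at this; omega⟩

theorem diagRow_strictMono (m n : ℕ) (d : Fin n ⊕ Fin (m - 1)) : StrictMono (diagRow m n d) :=
  fun i j h => by simpa [diagRow] using h

theorem diagCol_strictMono (m n : ℕ) (d : Fin n ⊕ Fin (m - 1)) : StrictMono (diagCol m n d) :=
  fun i j h => by simpa [diagCol] using h

theorem diagCell_injective (m n : ℕ) : Function.Injective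
    fun x : (d : Fin n ⊕ Fin (m - 1)) × Fin (diagLen m n d) =>
      (diagRow m n x.1 x.2, diagCol m n x.1 x.2) := by
  rintro ⟨d, s⟩ ⟨d', s'⟩ h
  simp only [diagRow, diagCol, Prod.mk.injEq, Fin.mk.injEq] at h
  obtain rfl : d = d' := by
    rcases d with b | a <;> rcases d' with b' | a' <;>
      simp only [diagStart, Sum.elim_inl, Sum.elim_inr] at h
    · exact congrArg _ (Fin.ext (by omega))
    · omega
    · omega
    · exact congrArg _ (Fin.ext (by omega))
  obtain rfl : s = s' := Fin.ext (by omega)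
  rfl

theorem sum_diagLen_sub {m n : ℕ} (hm : 0 < m) (hmn : m ≤ n) (i : ℕ) :
    ∑ d, (diagLen m n d - i) = (m - i) * (n - i) := by
  have hsq (c : ℕ) : ∑ j ∈ Finset.range c, (j + 1 - i) + ∑ j ∈ Finset.range c, (j - i) =
      (c - i) * (c - i) := by
    induction c with
    | zero => simp
    | succ c ih =>
      rw [Finset.sum_range_succ, Finset.sum_range_succ, add_add_add_comm, ih]
      rcases lt_or_ge c i with h | h
      · simp [Nat.sub_eq_zero_of_le h, Nat.sub_eq_zero_of_le h.le]
      · obtain ⟨b, rfl⟩ := Nat.exists_eq_add_of_le h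
        rw [add_assoc, Nat.add_sub_cancel_left, Nat.add_sub_cancel_left]
        ring
  have hright : ∑ a : Fin (m - 1), (diagLen m n (Sum.inr a) - i) =
      ∑ j ∈ Finset.range m, (j - i) := by
    obtain ⟨c, rfl⟩ : ∃ c, m = c + 1 := ⟨m - 1, by omega⟩
    rw [Finset.sum_range_succ', Nat.zero_sub, add_zero, ← Finset.sum_range_reflect,
      ← Fin.sum_univ_eq_sum_range (fun j => c - 1 - j + 1 - i)]
    refine Finset.sum_congr rfl fun a _ => ?_
    have := a.2
    simp only [diagLen, diagStart, Sum.elim_inr]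
    omega
  have hleft : ∑ b : Fin n, (diagLen m n (Sum.inl b) - i) =
      ∑ j ∈ Finset.range n, (min m (j + 1) - i) := by
    rw [← Finset.sum_range_reflect, ← Fin.sum_univ_eq_sum_range
      (fun j => min m (n - 1 - j + 1) - i)]
    refine Finset.sum_congr rfl fun b _ => ?_
    have := b.2
    simp only [diagLen, diagStart, Sum.elim_inl]
    omega
  rw [Fintype.sum_sum_type, hright, hleft]
  clear hleft hright
  induction n, hmn using Nat.le_induction with
  | base =>
    rw [← hsq]
    congr 1
    refine Finset.sum_congr rfl fun j hj => ?_
    simp only [Finset.mem_range] at hj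
    omega
  | succ n hmn ih =>
    rw [Finset.sum_range_succ, add_right_comm, ih, min_eq_left (by omega)]
    rcases lt_or_ge m i with h | h
    · simp [Nat.sub_eq_zero_of_le h.le]
    · rw [Nat.sub_add_comm (h.trans hmn)]
      ring

/-- The product of the minors along all diagonals of the generic matrix. -/
noncomputable def diagProd (𝔽 : Type*) [Field 𝔽] (m n : ℕ) : MvPolynomial (Fin m × Fin n) 𝔽 :=
  ∏ d, ((genMat 𝔽 m n).submatrix (diagRow m n d) (diagCol m n d)).det

theorem prod_X_pow_notMem_bracketPow {𝔽 σ : Type*} [Field 𝔽] {p : ℕ} (hp : p.Prime) [CharP 𝔽 p]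
    {e r : ℕ} (hr : r < p ^ e) (T : Finset σ) :
    (∏ c ∈ T, (X c : MvPolynomial σ 𝔽)) ^ r ∉ bracketPow (maxIdl 𝔽 σ) (p ^ e) := by
  classical
  have h : (∏ c ∈ T, (X c : MvPolynomial σ 𝔽)) ^ r =
      monomial (r • ∑ c ∈ T, Finsupp.single c 1) 1 := by
    rw [show (∏ c ∈ T, (X c : MvPolynomial σ 𝔽)) = monomial (∑ c ∈ T, Finsupp.single c 1) 1 from
      (monomial_sum_one _ _).symm, monomial_pow, one_pow]
  rw [h, mem_bracketPow_maxIdl hp, support_monomial, if_neg one_ne_zero]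
  push Not
  refine ⟨_, Finset.mem_singleton_self _, fun i => ?_⟩
  simp only [Finsupp.smul_apply, Finsupp.finsetSum_apply, Finsupp.single_apply,
    Finset.sum_ite_eq', smul_eq_mul]
  split_ifs <;> omega

theorem diagProd_pow_notMem_bracketPow {𝔽 : Type*} [Field 𝔽] {p : ℕ} (hp : p.Prime) [CharP 𝔽 p]
    (m n : ℕ) {e r : ℕ} (hr : r < p ^ e) :
    diagProd 𝔽 m n ^ r ∉ bracketPow (maxIdl 𝔽 (Fin m × Fin n)) (p ^ e) := by
  intro h
  have hmem := leadingCoeff_diagWeight_mem hp e h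
  rw [map_pow, Polynomial.leadingCoeff_pow, diagProd, map_prod, Polynomial.leadingCoeff_prod,
    Finset.prod_congr rfl fun d _ => leadingCoeff_diagWeight_minor 𝔽 (diagRow_strictMono m n d)
      (diagCol_strictMono m n d), ← Fintype.prod_sigma'] at hmem
  refine prod_X_pow_notMem_bracketPow (𝔽 := 𝔽) hp hr
    (Finset.univ.map ⟨_, diagCell_injective m n⟩) ?_
  rwa [Finset.prod_map]

theorem minor_ne_zero (𝔽 : Type*) [Field 𝔽] {m n s : ℕ} {row : Fin s → Fin m}
    {col : Fin s → Fin n} (hrow : StrictMono row) (hcol : StrictMono col) :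
    ((genMat 𝔽 m n).submatrix row col).det ≠ 0 := by
  intro h
  have := leadingCoeff_diagWeight_minor 𝔽 hrow hcol
  rw [h, map_zero, Polynomial.leadingCoeff_zero] at this
  exact Finset.prod_ne_zero_iff.2 (fun i _ => X_ne_zero _) this.symm

theorem minor_le_maxMinorValue {𝔽 Γ₀ : Type*} [Field 𝔽] [LinearOrderedCommGroupWithZero Γ₀]
    {m n s : ℕ} (v : Valuation (MvPolynomial (Fin m × Fin n) 𝔽) Γ₀) {row : Fin s → Fin m}
    (hrow : StrictMono row) (col : Fin s → Fin n) :
    v ((genMat 𝔽 m n).submatrix row col).det ≤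
      maxMinorValue v (extMat 𝔽 m n) (genCols m n) s := by
  obtain ⟨u, hu, hdet⟩ := exists_det_extMat_eq_minor 𝔽 hrow.injective col
  exact hdet ▸ le_maxMinorValue v _ _ u hu

/-- A power of the product of the diagonal minors is integral over a power of `I_t`. -/
theorem exists_diagProd_pow_mem (𝔽 : Type*) [Field 𝔽] {m n t : ℕ} (ht : 0 < t) (htm : t ≤ m)
    (hmn : m ≤ n) {r N : ℕ} (hN : ∀ i < t, N * (t - i) ≤ r * ((m - i) * (n - i))) :
    ∃ d : ℕ, ∀ l : ℕ, diagProd 𝔽 m n ^ (r * (l + d)) ∈ minorsIdeal 𝔽 m n t ^ (N * l) := by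
  have hne : diagProd 𝔽 m n ≠ 0 := Finset.prod_ne_zero_iff.2 fun d _ =>
    minor_ne_zero 𝔽 (diagRow_strictMono m n d) (diagCol_strictMono m n d)
  simp only [pow_mul]
  refine exists_pow_add_mem_pow_of_valuation_le
    (FractionRing (MvPolynomial (Fin m × Fin n) 𝔽)) _ (pow_ne_zero r hne) fun B hB => ?_
  set v : Valuation (MvPolynomial (Fin m × Fin n) 𝔽) B.ValueGroup :=
    B.valuation.comap (algebraMap _ _) with hv
  have hv1 (f : MvPolynomial (Fin m × Fin n) 𝔽) : v f ≤ 1 := (B.valuation_le_one_iff _).2 (hB f)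
  have hv0 {f : MvPolynomial (Fin m × Fin n) 𝔽} (hf : f ≠ 0) : v f ≠ 0 := by
    rw [hv, Valuation.comap_apply, Valuation.ne_zero_iff, map_ne_zero_iff _
      (IsFractionRing.injective _ _)]
    exact hf
  set a := maxMinorValue v (extMat 𝔽 m n) (genCols m n)
  have ha1 (j : ℕ) : a j ≤ 1 := Finset.sup_le fun u _ => hv1 _
  have ha0 : a 0 = 1 := by
    refine le_antisymm (ha1 0) ?_
    have := minor_le_maxMinorValue v (row := Fin.elim0) (fun i => i.elim0) Fin.elim0
    simpa using this
  have hane (j : ℕ) (hj : j ≤ m) : a j ≠ 0 := by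
    refine (lt_of_lt_of_le (zero_lt_iff.2 (hv0 (minor_ne_zero 𝔽 (Fin.strictMono_castLE hj)
      (Fin.strictMono_castLE (hj.trans hmn)))))
      (minor_le_maxMinorValue v (Fin.strictMono_castLE hj) _)).ne'
  obtain ⟨u, hu, hvu, -⟩ := exists_eq_maxMinorValue v _ _ (hane t htm) fun _ => 0
  refine ⟨_, Ideal.pow_mem_pow (hu ▸ det_extMat_mem_minorsIdeal 𝔽 u) N, ?_⟩
  change v _ ≤ v _
  rw [map_pow, map_pow, hvu, diagProd, map_prod, ← Finset.prod_pow]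
  calc _ ≤ ∏ d, a (diagLen m n d) ^ r := Finset.prod_le_prod' fun d _ => pow_le_pow_left'
        (minor_le_maxMinorValue v (diagRow_strictMono m n d) _) r
    _ ≤ a t ^ N := prod_pow_le_pow_of_logConcave (M := m) (ℓ := diagLen m n) ha0 (ha1 1) hane
      (maxMinorValue_mul_le v _ _) (fun d => (min_le_left _ _).trans (Nat.sub_le _ _)) htm
      fun i hi => by rw [sum_diagLen_sub (by omega) hmn]; exact hN i hi

theorem minorsIdeal_le_maxIdl (𝔽 : Type*) [Field 𝔽] {m n t : ℕ} (ht : 0 < t) :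
    minorsIdeal 𝔽 m n t ≤ maxIdl 𝔽 (Fin m × Fin n) := by
  rw [minorsIdeal, Ideal.span_le]
  rintro _ ⟨row, col, -, -, rfl⟩
  rw [Matrix.det_apply]
  refine sum_mem fun σ _ => ?_
  rw [Units.smul_def]
  refine zsmul_mem ?_ _
  rw [← Finset.mul_prod_erase _ _ (Finset.mem_univ ⟨0, ht⟩)]
  exact Ideal.mul_mem_right _ _ (Ideal.subset_span ⟨_, rfl⟩)

/-- The quotient `(m-j)(n-j)/(t-j)` is minimal at the least `k` with `minCond t m n k`. -/
theorem div_le_div_of_minCond {t m n k j : ℕ} (htm : t ≤ m) (hmn : m ≤ n) (hk : k ≤ t - 1)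
    (hCk : minCond t m n k) (hleast : ∀ i < k, ¬ minCond t m n i) (hj : j < t) :
    (((m - k) * (n - k) : ℕ) : ℝ) / ((t - k : ℕ) : ℝ) ≤
      (((m - j) * (n - j) : ℕ) : ℝ) / ((t - j : ℕ) : ℝ) := by
  rcases le_or_gt k j with hkj | hjk
  · rcases hCk with rfl | hCk
    · obtain rfl : j = t - 1 := by omega
      rfl
    · rcases hkj.eq_or_lt with rfl | hkj
      · rfl
      have hτ : (0 : ℝ) < ((t - k : ℕ) : ℝ) := by exact_mod_cast (by omega : 0 < t - k)
      rw [div_le_div_iff₀ hτ (by exact_mod_cast (by omega : 0 < t - k - 1)), Nat.sub_sub,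
        Nat.sub_sub, Nat.sub_sub] at hCk
      rw [div_le_div_iff₀ hτ (by exact_mod_cast (by omega : 0 < t - j))]
      push_cast [Nat.cast_sub (show k ≤ t by omega), Nat.cast_sub (show k ≤ m by omega),
        Nat.cast_sub (show k ≤ n by omega), Nat.cast_sub (show j ≤ t by omega),
        Nat.cast_sub (show j ≤ m by omega), Nat.cast_sub (show j ≤ n by omega),
        Nat.cast_sub (show k + 1 ≤ t by omega), Nat.cast_sub (show k + 1 ≤ m by omega),
        Nat.cast_sub (show k + 1 ≤ n by omega)] at hCk hτ ⊢
      have hi : (k : ℝ) + 1 ≤ j := by exact_mod_cast hkj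
      nlinarith [mul_nonneg (sub_nonneg.2 hCk) (by linarith : (0 : ℝ) ≤ j - k),
        mul_nonneg (mul_nonneg hτ.le (by linarith : (0 : ℝ) ≤ j - k))
          (by linarith : (0 : ℝ) ≤ j - k - 1)]
  · have hanti : ∀ i, j ≤ i → i ≤ k → (((m - i) * (n - i) : ℕ) : ℝ) / ((t - i : ℕ) : ℝ) ≤
        (((m - j) * (n - j) : ℕ) : ℝ) / ((t - j : ℕ) : ℝ) := by
      intro i hji
      induction i, hji using Nat.le_induction with
      | base => exact fun _ => le_rfl
      | succ i hji ih =>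
        intro hik
        have h := hleast i (by omega)
        simp only [minCond, not_or, not_le, Nat.sub_sub] at h
        exact h.2.le.trans (ih (by omega))
    exact hanti k hjk.le le_rfl
/-- Let `k` be the least integer in `[0, t-1]` with
`(m-k)(n-k)/(t-k) ≤ (m-k-1)(n-k-1)/(t-k-1)` (division by zero read as infinity).  Then
there is a `D ∈ ℕ` such that for every `q = p^e` one has `ν_{I_t}(q) ≥ (m-k)(n-k)·l` for
every `l ≥ 1` with `l ≤ (q-1-D)/(t-k)`; consequently the `F`-pure threshold of `I_t`
satisfies `fpt(I_t) ≥ (m-k)(n-k)/(t-k)`, which equals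
`min { (m-j)(n-j)/(t-j) | j = 0, …, t-1 }`. -/
theorem fpt_determinantal_ge (p : ℕ) (hp : p.Prime)
    (𝔽 : Type*) [Field 𝔽] [CharP 𝔽 p]
    (m n t : ℕ) (ht : 0 < t) (htm : t ≤ m) (hmn : m ≤ n)
    (k : ℕ) (hk : k ≤ t - 1) (hCk : minCond t m n k)
    (hleast : ∀ j : ℕ, j < k → ¬ minCond t m n j) :
    (∃ D : ℕ, ∀ e : ℕ, 1 ≤ e → ∀ l : ℕ, 1 ≤ l →
      (l : ℝ) ≤ (((p : ℝ) ^ e - 1 - (D : ℝ)) / ((t - k : ℕ) : ℝ)) →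
      (m - k) * (n - k) * l ≤ nu (minorsIdeal 𝔽 m n t) (p ^ e)) ∧
    (∃ fpt : ℝ,
      Filter.Tendsto (fun e : ℕ => (nu (minorsIdeal 𝔽 m n t) (p ^ e) : ℝ) / (p ^ e : ℕ))
        Filter.atTop (nhds fpt) ∧
      (((m - k) * (n - k) : ℕ) : ℝ) / ((t - k : ℕ) : ℝ) ≤ fpt) ∧
    (((m - k) * (n - k) : ℕ) : ℝ) / ((t - k : ℕ) : ℝ) =
      ⨅ j : Fin t, (((m - (j : ℕ)) * (n - (j : ℕ)) : ℕ) : ℝ) / ((t - (j : ℕ) : ℕ) : ℝ) := by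
  have hr : 0 < t - k := by omega
  have hr' : (0 : ℝ) < ((t - k : ℕ) : ℝ) := by exact_mod_cast hr
  have hmin (i : ℕ) (hi : i < t) := div_le_div_of_minCond htm hmn hk hCk hleast hi
  have hI := minorsIdeal_le_maxIdl 𝔽 (m := m) (n := n) ht
  obtain ⟨d, hd⟩ := exists_diagProd_pow_mem 𝔽 ht htm hmn (r := t - k) (N := (m - k) * (n - k))
    fun i hi => by
      have h := hmin i hi
      rw [div_le_div_iff₀ hr' (by exact_mod_cast (by omega : 0 < t - i))] at h
      rw [mul_comm (t - k)]
      exact_mod_cast h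
  have hnu (e l : ℕ) (h : (l : ℝ) ≤ ((p : ℝ) ^ e - 1 - ((t - k) * d : ℕ)) / ((t - k : ℕ) : ℝ)) :
      (m - k) * (n - k) * l ≤ nu (minorsIdeal 𝔽 m n t) (p ^ e) := by
    refine le_nu hp hI e fun hle =>
      diagProd_pow_notMem_bracketPow hp m n (r := (t - k) * (l + d)) (e := e) ?_ (hle (hd l))
    rw [le_div_iff₀ hr'] at h
    have : (((t - k) * (l + d) + 1 : ℕ) : ℝ) ≤ (p ^ e : ℕ) := by
      push_cast at h ⊢
      linarith
    exact_mod_cast this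
  refine ⟨⟨_, fun e _ l _ => hnu e l⟩, ?_, ?_⟩
  · obtain ⟨c, hc⟩ := exists_tendsto_nu_div hp hI
    refine ⟨c, hc, ?_⟩
    set N : ℝ := (((m - k) * (n - k) : ℕ) : ℝ) with hN
    set r : ℝ := ((t - k : ℕ) : ℝ)
    set D : ℝ := (((t - k) * d : ℕ) : ℝ)
    have hpow : Filter.Tendsto (fun e : ℕ => ((p ^ e : ℕ) : ℝ)) Filter.atTop Filter.atTop :=
      tendsto_natCast_atTop_atTop.comp (tendsto_pow_atTop_atTop_of_one_lt hp.one_lt)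
    have hlow : Filter.Tendsto (fun e : ℕ => N / r - N * ((1 + D) / r + 1) / ((p ^ e : ℕ) : ℝ))
        Filter.atTop (nhds (N / r)) := by
      simpa using (hpow.const_div_atTop (N * ((1 + D) / r + 1))).const_sub (N / r)
    refine le_of_tendsto_of_tendsto hlow hc ?_
    filter_upwards [hpow.eventually_ge_atTop (1 + D)] with e he
    have hq : (0 : ℝ) < ((p ^ e : ℕ) : ℝ) := by exact_mod_cast pow_pos hp.pos e
    have hx : 0 ≤ (((p ^ e : ℕ) : ℝ) - 1 - D) / r := div_nonneg (by linarith) hr'.le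
    have hfloor := hnu e ⌊(((p ^ e : ℕ) : ℝ) - 1 - D) / r⌋₊ (by
      simpa using Nat.floor_le hx)
    have hfloor' : N * (⌊(((p ^ e : ℕ) : ℝ) - 1 - D) / r⌋₊ : ℝ) ≤
        (nu (minorsIdeal 𝔽 m n t) (p ^ e) : ℝ) := by
      rw [hN]
      exact_mod_cast hfloor
    rw [le_div_iff₀ hq, sub_mul, div_mul_cancel₀ _ hq.ne']
    refine le_trans ?_ hfloor'
    have hlt := (Nat.lt_floor_add_one ((((p ^ e : ℕ) : ℝ) - 1 - D) / r)).le
    have := mul_le_mul_of_nonneg_left hlt (Nat.cast_nonneg _ : 0 ≤ N)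
    calc _ = N * ((((p ^ e : ℕ) : ℝ) - 1 - D) / r) - N := by ring
      _ ≤ _ := by linarith
  · have : Nonempty (Fin t) := ⟨⟨0, ht⟩⟩
    exact le_antisymm (le_ciInf fun j => hmin j j.2)
      (ciInf_le (Set.finite_range _).bddBelow (⟨k, by omega⟩ : Fin t))
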